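/- In every state of the legitimate set L of the alternating bit protocol, exactly one action is enabled, and executing it yields a state again in L; specifically, from a state with cd = some ns and ca = none the unique enabled action is reply and it yields the state with cd = none, ca = some ns, nr = ns (with ns unchanged), and from a state with cd = none, ca = some ns, nr = ns the unique enabled action is next and it yields the state with ns replaced by ¬ns, cd = some (¬ns), ca = none. Consequently, in every state of L exactly one message is present in the two channels and it carries the sender's current sequence number, and along the (deterministic) computation within L the value of ns alternates, each change of ns being followed by nr being set equal to ns. -/

import Mathlib

/-- A state of the alternating bit protocol: the sender's and receiver's
boolean sequence numbers `ns`, `nr`, the data channel `cd` (sender to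
receiver) and the ack channel `ca` (receiver to sender), each of capacity
one. -/
structure ABPState where
  ns : Bool
  nr : Bool
  cd : Option Bool
  ca : Option Bool
deriving DecidableEq

/-- Sending message `m` on a channel of capacity one: if the channel is empty
the message is placed in it, otherwise the new message is lost. -/
def send (c : Option Bool) (m : Bool) : Option Bool :=
  match c with
  | none => some m
  | some x => some x

/-- One step of the alternating bit protocol: `t` is obtained from `s` by
executing one enabled action (`next`, `timeout` or `reply`). -/
def abpStep (s t : ABPState) : Prop :=
  -- next: receive ack(a); if a = ns then flip ns and send data(ns)
  (∃ a, s.ca = some a ∧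
    t = if a = s.ns then
          ⟨!s.ns, s.nr, send s.cd (!s.ns), none⟩
        else
          ⟨s.ns, s.nr, s.cd, none⟩) ∨
  -- timeout: both channels empty; resend data(ns)
  (s.cd = none ∧ s.ca = none ∧ t = ⟨s.ns, s.nr, some s.ns, none⟩) ∨
  -- reply: receive data(b); if b ≠ nr then nr := b; send ack(b)
  (∃ b, s.cd = some b ∧
    t = ⟨s.ns, if b = s.nr then s.nr else b, none, send s.ca b⟩)

/-- The legitimate set `L` of the alternating bit protocol. -/
def Legit (s : ABPState) : Prop :=
  (s.cd = some s.ns ∧ s.ca = none) ∨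
  (s.cd = none ∧ s.ca = some s.ns ∧ s.nr = s.ns)

theorem step_of_data (s : ABPState) (h1 : s.cd = some s.ns) (h2 : s.ca = none) (t : ABPState) :
    abpStep s t ↔ t = ⟨s.ns, s.ns, none, some s.ns⟩ := by
  obtain ⟨ns, nr, cd, ca⟩ := s
  simp only at h1 h2
  subst h1 h2
  cases ns <;> cases nr <;> simp [abpStep, send]

theorem step_of_ack (s : ABPState) (h1 : s.cd = none) (h2 : s.ca = some s.ns) (t : ABPState) :
    abpStep s t ↔ t = ⟨!s.ns, s.nr, some (!s.ns), none⟩ := by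
  obtain ⟨ns, nr, cd, ca⟩ := s
  simp only at h1 h2
  subst h1 h2
  simp [abpStep, send]

theorem legit_step (s : ABPState) (h : Legit s) (t : ABPState) (ht : abpStep s t) : Legit t := by
  rcases h with ⟨h1, h2⟩ | ⟨h1, h2, _⟩
  · rw [step_of_data s h1 h2] at ht
    subst ht
    simp [Legit]
  · rw [step_of_ack s h1 h2] at ht
    subst ht
    simp [Legit]

/-- Within the legitimate set `L` of the alternating bit protocol: exactly one
action is enabled in every state of `L` and executing it stays in `L`; from a
state with `cd = some ns`, `ca = none` the unique enabled action is `reply`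
yielding `cd = none`, `ca = some ns`, `nr = ns`, `ns` unchanged; from a state
with `cd = none`, `ca = some ns`, `nr = ns` the unique enabled action is
`next` yielding `ns := ¬ns`, `cd = some (¬ns)`, `ca = none`. Consequently in
every state of `L` exactly one message is present in the channels and it
carries the sender's sequence number, and along computations in `L` every
change of `ns` is followed by `nr` being set equal to the new value of
`ns`. -/
theorem abp_legit_behavior :
    (∀ s : ABPState, Legit s → ∃! t, abpStep s t) ∧
    (∀ s : ABPState, Legit s → ∀ t, abpStep s t → Legit t) ∧
    (∀ s : ABPState, s.cd = some s.ns → s.ca = none →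
      ∀ t, abpStep s t → t = ⟨s.ns, s.ns, none, some s.ns⟩) ∧
    (∀ s : ABPState, s.cd = none → s.ca = some s.ns → s.nr = s.ns →
      ∀ t, abpStep s t → t = ⟨!s.ns, s.nr, some (!s.ns), none⟩) ∧
    (∀ s : ABPState, Legit s →
      ((s.cd = some s.ns ∧ s.ca = none) ∨ (s.cd = none ∧ s.ca = some s.ns))) ∧
    (∀ c : ℕ → ABPState, Legit (c 0) → (∀ n, abpStep (c n) (c (n + 1))) →
      ∀ n, (c (n + 1)).ns ≠ (c n).ns → (c (n + 2)).nr = (c (n + 1)).ns) := by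
  refine ⟨?_, legit_step, fun s h1 h2 t => (step_of_data s h1 h2 t).1,
    fun s h1 h2 _ t => (step_of_ack s h1 h2 t).1, ?_, ?_⟩
  · rintro s (⟨h1, h2⟩ | ⟨h1, h2, _⟩)
    · exact ⟨_, (step_of_data s h1 h2 _).2 rfl, fun t => (step_of_data s h1 h2 t).1⟩
    · exact ⟨_, (step_of_ack s h1 h2 _).2 rfl, fun t => (step_of_ack s h1 h2 t).1⟩
  · rintro s (h | ⟨h1, h2, _⟩)
    · exact Or.inl h
    · exact Or.inr ⟨h1, h2⟩
  · intro c h0 hc n hn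
    have hL : ∀ n, Legit (c n) := by
      intro n
      induction n with
      | zero => exact h0
      | succ k ih => exact legit_step _ ih _ (hc k)
    rcases hL n with ⟨h1, h2⟩ | ⟨h1, h2, _⟩
    · exact absurd (by rw [(step_of_data _ h1 h2 _).1 (hc n)]) hn
    · have e := (step_of_ack _ h1 h2 _).1 (hc n)
      have e2 := (step_of_data (c (n + 1)) (by rw [e]) (by rw [e]) _).1 (hc (n + 1))
      rw [show n + 2 = n + 1 + 1 from rfl, e2]
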